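/- There is an absolute constant C > 0 with the following property. Let 0 < σ₁ < σ₂ ≤ 1 and Λ > 0, for i = 1, 2 let ω_i be an admissible 2D density of range σ_i and mass scale Λ with ∫_{ℝ²} ω₁ = ∫_{ℝ²} ω₂, and define h(x) = (1/2π) ∫_{ℝ²} ln|x − ξ| (ω₁(ξ) − ω₂(ξ)) dξ. Then h is continuously differentiable on ℝ² and its gradient satisfies ‖∇h‖_{L²(ℝ²)} ≤ C Λ (1 + ln(1/σ₁))^{1/2}. -/

import Mathlib

open MeasureTheory

/-- An admissible 2D density of range `σ` and mass scale `Λ`: a measurable, nonnegative,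
radial function on `ℝ²` supported in the ball of radius `σ`, bounded by `Λ σ⁻²`, and of
total mass at most `Λ`. -/
def IsAdmissibleDensity (σ Λ : ℝ) (ω : EuclideanSpace ℝ (Fin 2) → ℝ) : Prop :=
  Measurable ω ∧ (∀ x, 0 ≤ ω x) ∧ (∀ x y, ‖x‖ = ‖y‖ → ω x = ω y) ∧
    (∀ x, ω x ≠ 0 → ‖x‖ ≤ σ) ∧ (∀ x, ω x ≤ Λ / σ ^ 2) ∧ (∫ x, ω x) ≤ Λ

/-- The 2D logarithmic potential `h(x) = (1/2π) ∫ ln|x−ξ| (ω₁(ξ) − ω₂(ξ)) dξ`. -/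
noncomputable def logPotential (ω₁ ω₂ : EuclideanSpace ℝ (Fin 2) → ℝ)
    (x : EuclideanSpace ℝ (Fin 2)) : ℝ :=
  (1 / (2 * Real.pi)) * ∫ ξ, Real.log ‖x - ξ‖ * (ω₁ ξ - ω₂ ξ)

section Integrability

variable {E : Type*} [NormedAddCommGroup E] [NormedSpace ℝ E] [FiniteDimensional ℝ E]
  [MeasurableSpace E] [BorelSpace E] {μ : Measure E} [μ.IsAddHaarMeasure]

/-- In dimension two the kernel `‖x - ξ‖⁻¹` is integrable against bounded measurable functions
with bounded support. -/
lemma integrable_inv_norm_sub_mul (hE : Module.finrank ℝ E = 2) {f : E → ℝ} {B R : ℝ}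
    (hf : Measurable f) (hB : ∀ x, |f x| ≤ B) (hR : ∀ x, f x ≠ 0 → ‖x‖ ≤ R) (x : E) :
    Integrable (fun ξ ↦ ‖x - ξ‖⁻¹ * f ξ) μ := by
  have : Nontrivial E := Module.nontrivial_of_finrank_pos (R := ℝ) (by omega)
  set S : ℝ := ‖x‖ + R + 1
  have hball : IntegrableOn (fun y : E ↦ ‖y‖⁻¹) (Metric.ball 0 S) μ := by
    rw [integrableOn_fun_norm_addHaar μ (f := fun r ↦ r⁻¹), hE]
    refine (integrableOn_const (C := (1 : ℝ)) (by simp)).congr_fun (fun y hy ↦ ?_) measurableSet_Ioo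
    simp [hy.1.ne']
  have hS := ((integrable_indicator_iff Metric.isOpen_ball.measurableSet).2 hball).comp_sub_left x
  refine (hS.mul_const B).mono' (by fun_prop) (.of_forall fun ξ ↦ ?_)
  by_cases h : f ξ = 0
  · simp only [h, mul_zero, norm_zero]
    exact mul_nonneg (Set.indicator_nonneg (fun _ _ ↦ by positivity) _)
      ((abs_nonneg _).trans (hB ξ))
  · have hmem : x - ξ ∈ Metric.ball (0 : E) S := by
      rw [mem_ball_zero_iff]
      linarith [norm_sub_le x ξ, hR ξ h]
    rw [Set.indicator_of_mem hmem, norm_mul, norm_inv, norm_norm]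
    gcongr
    exact hB ξ

lemma integrable_of_bounded_support {f : E → ℝ} {B R : ℝ}
    (hf : Measurable f) (hB : ∀ x, |f x| ≤ B) (hR : ∀ x, f x ≠ 0 → ‖x‖ ≤ R) :
    Integrable f μ := by
  have hS : IntegrableOn (fun _ ↦ B) (Metric.closedBall (0 : E) R) μ :=
    integrableOn_const measure_closedBall_lt_top.ne
  refine ((integrable_indicator_iff Metric.isClosed_closedBall.measurableSet).2 hS).mono'
    hf.aestronglyMeasurable (.of_forall fun ξ ↦ ?_)
  by_cases h : f ξ = 0
  · simp only [h, norm_zero]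
    exact Set.indicator_nonneg (fun _ _ ↦ (abs_nonneg _).trans (hB ξ)) _
  · rw [Set.indicator_of_mem (by simpa using hR ξ h)]
    exact hB ξ

lemma abs_log_le_add_inv {t : ℝ} (ht : 0 ≤ t) : |Real.log t| ≤ t + t⁻¹ := by
  have h1 := Real.log_le_self ht
  have h2 := Real.log_le_self (inv_nonneg.2 ht)
  rw [Real.log_inv] at h2
  have := inv_nonneg.2 ht
  rw [abs_le]
  constructor <;> linarith

lemma integrable_log_norm_sub_mul (hE : Module.finrank ℝ E = 2) {f : E → ℝ} {B R : ℝ}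
    (hf : Measurable f) (hB : ∀ x, |f x| ≤ B) (hR : ∀ x, f x ≠ 0 → ‖x‖ ≤ R) (x : E) :
    Integrable (fun ξ ↦ Real.log ‖x - ξ‖ * f ξ) μ := by
  have h1 := (integrable_inv_norm_sub_mul hE hf hB hR x (μ := μ)).norm
  have h2 := (integrable_of_bounded_support hf hB hR (μ := μ)).norm.const_mul (‖x‖ + R)
  refine (h1.add h2).mono' (by fun_prop) (.of_forall fun ξ ↦ ?_)
  by_cases h : f ξ = 0
  · simp [h]
  · simp only [norm_mul, norm_inv, norm_norm, Pi.add_apply]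
    rw [← add_mul]
    gcongr
    rw [Real.norm_eq_abs]
    linarith [abs_log_le_add_inv (norm_nonneg (x - ξ)), norm_sub_le x ξ, hR ξ h]

end Integrability

section Newton

/-- Radial convolution kernels applied to radial functions give radial functions. -/
lemma integral_norm_circleMap_sub_mul {f : ℂ → ℝ} (hrad : ∀ x y, ‖x‖ = ‖y‖ → f x = f y)
    (k : ℝ → ℝ) (r θ : ℝ) :
    ∫ w, k ‖circleMap 0 r θ - w‖ * f w = ∫ w, k ‖(r : ℂ) - w‖ * f w := by
  rw [← (rotation (Circle.exp θ)).measurePreserving.integral_comp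
    (rotation (Circle.exp θ)).toHomeomorph.measurableEmbedding]
  congr 1 with w
  have h1 : circleMap 0 r θ = rotation (Circle.exp θ) r := by
    simp [circleMap, mul_comm]
  rw [h1, ← map_sub, LinearIsometryEquiv.norm_map, hrad _ _ (LinearIsometryEquiv.norm_map _ w)]

lemma log_add_posLog_inv_mul {r s : ℝ} (hr : 0 < r) (hs : 0 ≤ s) :
    Real.log r + Real.posLog (r⁻¹ * s) = Real.log (max r s) := by
  rcases le_or_gt s r with h | h
  · rw [max_eq_left h, (Real.posLog_eq_zero_iff _).2, add_zero]
    rw [abs_of_nonneg (by positivity), inv_mul_le_iff₀ hr]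
    linarith
  · have hs' : 0 < s := hr.trans h
    rw [max_eq_right h.le, Real.posLog_eq_log, Real.log_mul (by positivity) (by positivity),
      Real.log_inv]
    · ring
    · rw [abs_of_nonneg (by positivity), le_inv_mul_iff₀ hr]
      linarith

/-- Newton's theorem for the logarithmic kernel in the complex plane. -/
lemma Complex.integral_log_norm_sub_mul_radial {f : ℂ → ℝ} {B R : ℝ}
    (hf : Measurable f) (hB : ∀ x, |f x| ≤ B) (hR : ∀ x, f x ≠ 0 → ‖x‖ ≤ R)
    (hrad : ∀ x y, ‖x‖ = ‖y‖ → f x = f y) (z : ℂ) :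
    ∫ w, Real.log ‖z - w‖ * f w = ∫ w, Real.log (max ‖z‖ ‖w‖) * f w := by
  rcases eq_or_ne z 0 with rfl | hz
  · simp
  have hr : 0 < ‖z‖ := norm_pos_iff.2 hz
  have hint : Integrable (fun p : ℝ × ℂ ↦ Real.log ‖circleMap 0 ‖z‖ p.1 - p.2‖ * f p.2)
      ((volume.restrict (Set.Ioc 0 (2 * Real.pi))).prod volume) := by
    have hm : Measurable fun p : ℝ × ℂ ↦ Real.log ‖circleMap 0 ‖z‖ p.1 - p.2‖ * f p.2 := by
      have : Measurable (circleMap 0 ‖z‖) := (continuous_circleMap 0 ‖z‖).measurable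
      fun_prop
    rw [integrable_prod_iff hm.aestronglyMeasurable]
    have hθ (θ : ℝ) : Integrable fun w ↦ Real.log ‖circleMap 0 ‖z‖ θ - w‖ * f w :=
      integrable_log_norm_sub_mul Complex.finrank_real_complex hf hB hR _
    refine ⟨.of_forall hθ, ?_⟩
    simp only [norm_mul]
    have h := integral_norm_circleMap_sub_mul (f := fun w ↦ ‖f w‖)
      (fun x y h ↦ by simp only [hrad x y h]) (fun t ↦ ‖Real.log t‖) ‖z‖
    simp only [h]
    exact integrable_const _
  have hswap := integral_integral_swap (f := fun θ w ↦ Real.log ‖circleMap 0 ‖z‖ θ - w‖ * f w) hint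
  have hz' : ∀ θ, ∫ w, Real.log ‖circleMap 0 ‖z‖ θ - w‖ * f w = ∫ w, Real.log ‖z - w‖ * f w := by
    intro θ
    have h := integral_norm_circleMap_sub_mul hrad Real.log ‖z‖
    have hzz : circleMap 0 ‖z‖ z.arg = z := by simp [circleMap]
    rw [h θ, ← h z.arg, hzz]
  simp only [hz', integral_const, integral_mul_const] at hswap
  have hpi := Real.pi_pos
  have havg : ∀ w : ℂ, ∫ θ in Set.Ioc 0 (2 * Real.pi), Real.log ‖circleMap 0 ‖z‖ θ - w‖
      = 2 * Real.pi * Real.log (max ‖z‖ ‖w‖) := by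
    intro w
    have h := circleAverage_log_norm_sub_const_eq_log_radius_add_posLog (a := w) (c := 0) hr.ne'
    rw [Real.circleAverage_def, intervalIntegral.integral_of_le (by positivity), zero_sub, norm_neg,
      log_add_posLog_inv_mul hr (norm_nonneg w), smul_eq_mul,
      inv_mul_eq_iff_eq_mul₀ (by positivity)] at h
    exact h
  simp only [havg, mul_assoc] at hswap
  rw [integral_const_mul, integral_const_mul] at hswap
  simpa [hpi.le, hpi.ne', mul_assoc] using hswap

/-- Newton's theorem for the logarithmic kernel in the Euclidean plane. -/
lemma integral_log_norm_sub_mul_radial {f : EuclideanSpace ℝ (Fin 2) → ℝ} {B R : ℝ}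
    (hf : Measurable f) (hB : ∀ x, |f x| ≤ B) (hR : ∀ x, f x ≠ 0 → ‖x‖ ≤ R)
    (hrad : ∀ x y, ‖x‖ = ‖y‖ → f x = f y) (x : EuclideanSpace ℝ (Fin 2)) :
    ∫ ξ, Real.log ‖x - ξ‖ * f ξ = ∫ ξ, Real.log (max ‖x‖ ‖ξ‖) * f ξ := by
  let e := Complex.orthonormalBasisOneI.repr
  have hme := e.toHomeomorph.measurableEmbedding
  obtain ⟨z, rfl⟩ := e.surjective x
  rw [← e.measurePreserving.integral_comp hme, ← e.measurePreserving.integral_comp hme]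
  simp only [← map_sub, LinearIsometryEquiv.norm_map]
  exact Complex.integral_log_norm_sub_mul_radial (f := fun w ↦ f (e w))
    (hf.comp e.continuous.measurable) (fun w ↦ hB _) (fun w hw ↦ by simpa using hR _ hw)
    (fun v w h ↦ hrad _ _ (by simpa using h)) z

end Newton

section Gradient

lemma abs_log_max_sub_log_max_le {a b s : ℝ} (hs : 0 < s) :
    |Real.log (max a s) - Real.log (max b s)| ≤ s⁻¹ * |a - b| := by
  have key : ∀ u v : ℝ, s ≤ u → s ≤ v → Real.log u - Real.log v ≤ s⁻¹ * |u - v| := by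
    intro u v hu hv
    have hu0 := hs.trans_le hu
    have hv0 := hs.trans_le hv
    rw [← Real.log_div hu0.ne' hv0.ne']
    calc Real.log (u / v) ≤ u / v - 1 := Real.log_le_sub_one_of_pos (by positivity)
      _ = v⁻¹ * (u - v) := by field_simp
      _ ≤ v⁻¹ * |u - v| := by gcongr; exact le_abs_self _
      _ ≤ s⁻¹ * |u - v| := by gcongr
  have h1 := key _ _ (le_max_right a s) (le_max_right b s)
  have h2 := key _ _ (le_max_right b s) (le_max_right a s)
  rw [abs_sub_comm (max b s)] at h2
  have h3 := mul_le_mul_of_nonneg_left (abs_max_sub_max_le_abs a b s) (inv_nonneg.2 hs.le)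
  rw [abs_le]
  constructor <;> linarith

variable {E : Type*} [NormedAddCommGroup E] [InnerProductSpace ℝ E]

/-- The derivative of `x ↦ log (max ‖x‖ s)` off the sphere of radius `s`. -/
noncomputable def logMaxFDeriv (s : ℝ) (x : E) : E →L[ℝ] ℝ :=
  (if s < ‖x‖ then (‖x‖ ^ 2)⁻¹ else 0) • innerSL ℝ x

lemma hasFDerivAt_log_max_norm {x : E} {s : ℝ} (h : s ≠ ‖x‖) (hs : 0 ≤ s) :
    HasFDerivAt (fun x : E ↦ Real.log (max ‖x‖ s)) (logMaxFDeriv s x) x := by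
  unfold logMaxFDeriv
  rcases lt_or_gt_of_ne h with h | h
  · have hx : ‖x‖ ≠ 0 := (hs.trans_lt h).ne'
    have h1 := ((hasStrictFDerivAt_norm_sq x).hasFDerivAt.log (by positivity)).const_mul (1 / 2 : ℝ)
    rw [if_pos h]
    refine (h1.congr_fderiv ?_).congr_of_eventuallyEq ?_
    · ext y
      simp
      ring
    · filter_upwards [continuous_norm.continuousAt.eventually (lt_mem_nhds h)] with y hy
      rw [max_eq_left hy.le, Real.log_pow]
      push_cast
      ring
  · rw [if_neg h.not_gt, zero_smul]
    refine (hasFDerivAt_const (Real.log s) x).congr_of_eventuallyEq ?_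
    filter_upwards [continuous_norm.continuousAt.eventually (gt_mem_nhds h)] with y hy
    rw [max_eq_right (le_of_lt hy)]

lemma norm_logMaxFDeriv_le {s : ℝ} (hs : 0 < s) (x : E) : ‖logMaxFDeriv s x‖ ≤ s⁻¹ := by
  unfold logMaxFDeriv
  split_ifs with h
  · have hx : 0 < ‖x‖ := hs.trans h
    rw [norm_smul, innerSL_apply_norm, norm_inv, norm_pow, norm_norm]
    calc (‖x‖ ^ 2)⁻¹ * ‖x‖ = ‖x‖⁻¹ := by field_simp
      _ ≤ s⁻¹ := by gcongr
  · simpa using hs.le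

lemma continuousAt_logMaxFDeriv {x : E} {s : ℝ} (h : s ≠ ‖x‖) (hs : 0 ≤ s) :
    ContinuousAt (fun x : E ↦ logMaxFDeriv s x) x := by
  unfold logMaxFDeriv
  have hinner : ContinuousAt (fun x : E ↦ innerSL ℝ x) x := by fun_prop
  refine ContinuousAt.smul (M := ℝ) ?_ hinner
  rcases lt_or_gt_of_ne h with h | h
  · have hx : ‖x‖ ^ 2 ≠ 0 := pow_ne_zero _ (hs.trans_lt h).ne'
    refine ((continuous_norm.pow 2).continuousAt.inv₀ hx).congr ?_
    filter_upwards [continuous_norm.continuousAt.eventually (lt_mem_nhds h)] with y hy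
    exact (if_pos hy).symm
  · refine (continuousAt_const (y := 0)).congr ?_
    filter_upwards [continuous_norm.continuousAt.eventually (gt_mem_nhds h)] with y hy
    exact (if_neg (not_lt.2 (le_of_lt hy))).symm

variable [MeasurableSpace E] [BorelSpace E]

lemma measurable_logMaxFDeriv_norm (x : E) : Measurable fun ξ : E ↦ logMaxFDeriv ‖ξ‖ x := by
  unfold logMaxFDeriv
  have h : Measurable fun ξ : E ↦ if ‖ξ‖ < ‖x‖ then (‖x‖ ^ 2)⁻¹ else 0 :=
    Measurable.ite (measurableSet_lt measurable_norm measurable_const) measurable_const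
      measurable_const
  have hc : Continuous fun t : ℝ ↦ t • innerSL ℝ x := by fun_prop
  exact hc.measurable.comp h

lemma integral_smul_logMaxFDeriv {μ : Measure E} {f : E → ℝ} (x : E) :
    ∫ ξ, f ξ • logMaxFDeriv ‖ξ‖ x ∂μ
      = ((∫ ξ in Metric.ball 0 ‖x‖, f ξ ∂μ) * (‖x‖ ^ 2)⁻¹) • innerSL ℝ x := by
  simp only [logMaxFDeriv, smul_smul]
  rw [integral_smul_const, ← integral_mul_const, ← integral_indicator measurableSet_ball]
  congr 2 with ξ
  by_cases h : ‖ξ‖ < ‖x‖ <;> simp [h]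

variable [FiniteDimensional ℝ E] {μ : Measure E} [μ.IsAddHaarMeasure]

lemma ae_norm_ne [Nontrivial E] (r : ℝ) : ∀ᵐ ξ ∂μ, ‖ξ‖ ≠ r := by
  rw [ae_iff]
  simpa [Metric.sphere, dist_zero_right] using Measure.addHaar_sphere μ (0 : E) r

variable {f : E → ℝ} {B R : ℝ}

lemma hasFDerivAt_integral_log_max_norm (hE : Module.finrank ℝ E = 2)
    (hf : Measurable f) (hB : ∀ x, |f x| ≤ B) (hR : ∀ x, f x ≠ 0 → ‖x‖ ≤ R) (x : E) :
    HasFDerivAt (fun x ↦ ∫ ξ, Real.log (max ‖x‖ ‖ξ‖) * f ξ ∂μ)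
      (∫ ξ, f ξ • logMaxFDeriv ‖ξ‖ x ∂μ) x := by
  have : Nontrivial E := Module.nontrivial_of_finrank_pos (R := ℝ) (by omega)
  have hb := (integrable_inv_norm_sub_mul hE hf hB hR 0 (μ := μ)).norm
  have hlog := integrable_log_norm_sub_mul hE hf hB hR 0 (μ := μ)
  simp only [zero_sub, norm_neg, norm_mul, norm_inv, norm_norm] at hb hlog
  have hlip (y z : E) {ξ : E} (hξ : ‖ξ‖ ≠ 0) :
      ‖Real.log (max ‖y‖ ‖ξ‖) * f ξ - Real.log (max ‖z‖ ‖ξ‖) * f ξ‖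
        ≤ ‖ξ‖⁻¹ * ‖f ξ‖ * ‖y - z‖ := by
    rw [← sub_mul, norm_mul, mul_right_comm]
    gcongr
    refine (abs_log_max_sub_log_max_le (by positivity)).trans ?_
    gcongr
    exact abs_norm_sub_norm_le y z
  have hmeas (y : E) : Measurable fun ξ ↦ Real.log (max ‖y‖ ‖ξ‖) * f ξ := by fun_prop
  have hint : Integrable (fun ξ ↦ Real.log (max ‖x‖ ‖ξ‖) * f ξ) μ := by
    refine (hlog.norm.add (hb.mul_const ‖x‖)).mono' (hmeas x).aestronglyMeasurable ?_
    filter_upwards [ae_norm_ne (μ := μ) 0] with ξ hξ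
    have h := hlip x 0 hξ
    rw [norm_zero, max_eq_right (norm_nonneg _), sub_zero] at h
    have := norm_le_norm_add_norm_sub' (Real.log (max ‖x‖ ‖ξ‖) * f ξ) (Real.log ‖ξ‖ * f ξ)
    simp only [Pi.add_apply]
    linarith
  refine (hasFDerivAt_integral_of_dominated_loc_of_lip' (s := Set.univ) Filter.univ_mem
    (fun y _ ↦ (hmeas y).aestronglyMeasurable) hint
    (hf.smul (measurable_logMaxFDeriv_norm x)).aestronglyMeasurable ?_ hb ?_).2
  · filter_upwards [ae_norm_ne (μ := μ) 0] with ξ hξ y _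
    exact hlip y x hξ
  · filter_upwards [ae_norm_ne (μ := μ) ‖x‖] with ξ hξ
    exact (hasFDerivAt_log_max_norm hξ (norm_nonneg _)).mul_const (f ξ)

lemma continuous_integral_smul_logMaxFDeriv (hE : Module.finrank ℝ E = 2)
    (hf : Measurable f) (hB : ∀ x, |f x| ≤ B) (hR : ∀ x, f x ≠ 0 → ‖x‖ ≤ R) :
    Continuous fun x : E ↦ ∫ ξ, f ξ • logMaxFDeriv ‖ξ‖ x ∂μ := by
  have : Nontrivial E := Module.nontrivial_of_finrank_pos (R := ℝ) (by omega)
  have hb := (integrable_inv_norm_sub_mul hE hf hB hR 0 (μ := μ)).norm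
  simp only [zero_sub, norm_neg, norm_mul, norm_inv, norm_norm] at hb
  refine continuous_iff_continuousAt.2 fun x ↦ continuousAt_of_dominated
    (.of_forall fun y ↦ (hf.smul (measurable_logMaxFDeriv_norm y)).aestronglyMeasurable)
    (.of_forall fun y ↦ ?_) hb ?_
  · filter_upwards [ae_norm_ne (μ := μ) 0] with ξ hξ
    rw [norm_smul, mul_comm]
    gcongr
    exact norm_logMaxFDeriv_le (by positivity) y
  · filter_upwards [ae_norm_ne (μ := μ) ‖x‖] with ξ hξ
    exact (continuousAt_logMaxFDeriv hξ (norm_nonneg _)).const_smul (f ξ)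

end Gradient

section Energy

lemma IsAdmissibleDensity.abs_le {σ Λ : ℝ} {ω : EuclideanSpace ℝ (Fin 2) → ℝ}
    (h : IsAdmissibleDensity σ Λ ω) (x : EuclideanSpace ℝ (Fin 2)) : |ω x| ≤ Λ / σ ^ 2 :=
  (abs_of_nonneg (h.2.1 x)).trans_le (h.2.2.2.2.1 x)

lemma IsAdmissibleDensity.integrable {σ Λ : ℝ} {ω : EuclideanSpace ℝ (Fin 2) → ℝ}
    (h : IsAdmissibleDensity σ Λ ω) : Integrable ω :=
  integrable_of_bounded_support h.1 h.abs_le h.2.2.2.1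

lemma IsAdmissibleDensity.setIntegral_nonneg {σ Λ : ℝ} {ω : EuclideanSpace ℝ (Fin 2) → ℝ}
    (h : IsAdmissibleDensity σ Λ ω) (s : Set (EuclideanSpace ℝ (Fin 2))) : 0 ≤ ∫ x in s, ω x :=
  integral_nonneg h.2.1

lemma IsAdmissibleDensity.setIntegral_le {σ Λ : ℝ} {ω : EuclideanSpace ℝ (Fin 2) → ℝ}
    (h : IsAdmissibleDensity σ Λ ω) (s : Set (EuclideanSpace ℝ (Fin 2))) : ∫ x in s, ω x ≤ Λ :=
  (setIntegral_le_integral h.integrable (.of_forall h.2.1)).trans h.2.2.2.2.2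

lemma volume_real_ball_fin_two {r : ℝ} (hr : 0 ≤ r) :
    volume.real (Metric.ball (0 : EuclideanSpace ℝ (Fin 2)) r) = Real.pi * r ^ 2 := by
  rw [measureReal_def, EuclideanSpace.volume_ball_fin_two, ENNReal.toReal_mul, ENNReal.toReal_pow,
    ENNReal.toReal_ofReal hr]
  simp [mul_comm, Real.pi_pos.le]

lemma IsAdmissibleDensity.setIntegral_ball_le {σ Λ : ℝ} {ω : EuclideanSpace ℝ (Fin 2) → ℝ}
    (h : IsAdmissibleDensity σ Λ ω) {r : ℝ} (hr : 0 ≤ r) :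
    ∫ x in Metric.ball 0 r, ω x ≤ Λ / σ ^ 2 * (Real.pi * r ^ 2) := by
  have := norm_setIntegral_le_of_norm_le_const (μ := volume)
    (s := Metric.ball (0 : EuclideanSpace ℝ (Fin 2)) r) measure_ball_lt_top
    (f := ω) (fun x _ ↦ h.abs_le x)
  rw [volume_real_ball_fin_two hr] at this
  exact (le_abs_self _).trans this

lemma integral_indicator_inv_sq_norm {σ : ℝ} (hσ : 0 < σ) (hσ' : σ ≤ 1) :
    Integrable (fun x : EuclideanSpace ℝ (Fin 2) ↦
        (Set.Ioc σ 1).indicator (fun r ↦ (r ^ 2)⁻¹) ‖x‖) ∧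
      ∫ x : EuclideanSpace ℝ (Fin 2), (Set.Ioc σ 1).indicator (fun r ↦ (r ^ 2)⁻¹) ‖x‖
        = 2 * Real.pi * Real.log (1 / σ) := by
  have hsub : Set.Ioc σ 1 ⊆ Set.Ioi 0 := fun y hy ↦ hσ.trans hy.1
  have heq : (fun y : ℝ ↦ y ^ (Module.finrank ℝ (EuclideanSpace ℝ (Fin 2)) - 1) •
      (Set.Ioc σ 1).indicator (fun r ↦ (r ^ 2)⁻¹) y)
        = (Set.Ioc σ 1).indicator (fun r ↦ r⁻¹) := by
    ext y
    by_cases hy : y ∈ Set.Ioc σ 1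
    · have : y ≠ 0 := (hsub hy).ne'
      simp only [hy, Set.indicator_of_mem, finrank_euclideanSpace, Fintype.card_fin, smul_eq_mul]
      field_simp
      norm_num
    · simp [hy]
  have hII : IntegrableOn (fun r : ℝ ↦ r⁻¹) (Set.Ioc σ 1) := by
    have : IntervalIntegrable (fun r : ℝ ↦ r⁻¹) volume σ 1 := by
      refine intervalIntegral.intervalIntegrable_inv (fun x hx ↦ ?_) continuousOn_id
      rw [Set.uIcc_of_le hσ'] at hx
      exact (hσ.trans_le hx.1).ne'
    exact (intervalIntegrable_iff_integrableOn_Ioc_of_le hσ').1 this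
  constructor
  · rw [integrable_fun_norm_addHaar volume, heq]
    exact ((integrable_indicator_iff measurableSet_Ioc).2 hII).integrableOn
  · rw [integral_fun_norm_addHaar volume, heq, setIntegral_indicator measurableSet_Ioc,
      Set.inter_eq_self_of_subset_right hsub, ← intervalIntegral.integral_of_le hσ',
      integral_inv_of_pos hσ one_pos, volume_real_ball_fin_two zero_le_one]
    simp
    ring

end Energy

theorem stmt16 :
    ∃ C > (0 : ℝ), ∀ σ₁ σ₂ Λ : ℝ, 0 < σ₁ → σ₁ < σ₂ → σ₂ ≤ 1 → 0 < Λ →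
      ∀ ω₁ ω₂ : EuclideanSpace ℝ (Fin 2) → ℝ,
        IsAdmissibleDensity σ₁ Λ ω₁ → IsAdmissibleDensity σ₂ Λ ω₂ →
        (∫ x, ω₁ x) = (∫ x, ω₂ x) →
        ContDiff ℝ 1 (logPotential ω₁ ω₂) ∧
          Real.sqrt (∫ x, ‖gradient (logPotential ω₁ ω₂) x‖ ^ 2) ≤
            C * Λ * Real.sqrt (1 + Real.log (1 / σ₁)) := by
  refine ⟨1, one_pos, fun σ₁ σ₂ Λ hσ₁ hσ hσ₂ hΛ ω₁ ω₂ h₁ h₂ hmass ↦ ?_⟩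
  have hE : Module.finrank ℝ (EuclideanSpace ℝ (Fin 2)) = 2 := by simp
  set f : EuclideanSpace ℝ (Fin 2) → ℝ := fun x ↦ ω₁ x - ω₂ x
  have hf : Measurable f := h₁.1.sub h₂.1
  have hB (x) : |f x| ≤ Λ / σ₁ ^ 2 + Λ / σ₂ ^ 2 :=
    (abs_sub _ _).trans (add_le_add (h₁.abs_le x) (h₂.abs_le x))
  have hR (x) (hx : f x ≠ 0) : ‖x‖ ≤ 1 := by
    by_cases h : ω₁ x = 0
    · refine (h₂.2.2.2.1 x fun h' ↦ hx ?_).trans hσ₂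
      simp [f, h, h']
    · linarith [h₁.2.2.2.1 x h]
  have hrad (x y) (h : ‖x‖ = ‖y‖) : f x = f y := by
    simp only [f, h₁.2.2.1 x y h, h₂.2.2.1 x y h]
  have hpot : logPotential ω₁ ω₂
      = fun x ↦ (1 / (2 * Real.pi)) * ∫ ξ, Real.log (max ‖x‖ ‖ξ‖) * f ξ :=
    funext fun x ↦ congrArg _ (integral_log_norm_sub_mul_radial hf hB hR hrad x)
  have hderiv (x) : HasFDerivAt (logPotential ω₁ ω₂)
      ((1 / (2 * Real.pi)) • ∫ ξ, f ξ • logMaxFDeriv ‖ξ‖ x) x := by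
    rw [hpot]
    exact (hasFDerivAt_integral_log_max_norm hE hf hB hR x).const_mul _
  refine ⟨contDiff_one_iff_hasFDerivAt.2
    ⟨_, (continuous_integral_smul_logMaxFDeriv hE hf hB hR).const_smul (1 / (2 * Real.pi)),
      hderiv⟩, ?_⟩
  have hpi := Real.pi_pos
  have hlog : 0 ≤ Real.log (1 / σ₁) :=
    Real.log_nonneg ((one_le_div hσ₁).2 (by linarith))
  have hgrad (x) : ‖gradient (logPotential ω₁ ω₂) x‖
      = |∫ ξ in Metric.ball 0 ‖x‖, f ξ| / (2 * Real.pi * ‖x‖) := by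
    rw [gradient, LinearIsometryEquiv.norm_map, (hderiv x).fderiv, integral_smul_logMaxFDeriv,
      norm_smul, norm_smul, innerSL_apply_norm, norm_mul, norm_inv, norm_pow, norm_norm,
      Real.norm_eq_abs, Real.norm_eq_abs, abs_of_pos (by positivity)]
    rcases eq_or_ne ‖x‖ 0 with h | h
    · simp [h]
    · field_simp
  have hsplit (r : ℝ) : ∫ ξ in Metric.ball 0 r, f ξ
      = (∫ ξ in Metric.ball 0 r, ω₁ ξ) - ∫ ξ in Metric.ball 0 r, ω₂ ξ :=
    integral_sub h₁.integrable.integrableOn h₂.integrable.integrableOn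
  obtain ⟨hΨint, hΨ⟩ := integral_indicator_inv_sq_norm hσ₁ (hσ.le.trans hσ₂)
  set Ψ₁ : EuclideanSpace ℝ (Fin 2) → ℝ :=
    (Metric.closedBall 0 σ₁).indicator fun _ ↦ Λ ^ 2 / (4 * σ₁ ^ 2) with hΨ₁
  set Ψ₂ : EuclideanSpace ℝ (Fin 2) → ℝ := fun x ↦
    Λ ^ 2 / (4 * Real.pi ^ 2) * (Set.Ioc σ₁ 1).indicator (fun r ↦ (r ^ 2)⁻¹) ‖x‖ with hΨ₂
  have hle (x) : ‖gradient (logPotential ω₁ ω₂) x‖ ^ 2 ≤ Ψ₁ x + Ψ₂ x := by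
    rw [hgrad]
    rcases eq_or_ne ‖x‖ 0 with h0 | h0
    · have : x = 0 := norm_eq_zero.1 h0
      subst this
      simp [Ψ₁, Ψ₂, hσ₁.le, hσ₁.not_gt]
      positivity
    have hx : 0 < ‖x‖ := lt_of_le_of_ne (norm_nonneg _) h0.symm
    have ha₁ := h₁.setIntegral_nonneg (Metric.ball 0 ‖x‖)
    have ha₂ := h₂.setIntegral_nonneg (Metric.ball 0 ‖x‖)
    by_cases hxσ : ‖x‖ ≤ σ₁
    · have hm : |∫ ξ in Metric.ball 0 ‖x‖, f ξ| ≤ Λ / σ₁ ^ 2 * (Real.pi * ‖x‖ ^ 2) := by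
        have hb₁ := h₁.setIntegral_ball_le hx.le
        have hb₂ := h₂.setIntegral_ball_le hx.le
        have : Λ / σ₂ ^ 2 * (Real.pi * ‖x‖ ^ 2) ≤ Λ / σ₁ ^ 2 * (Real.pi * ‖x‖ ^ 2) := by
          gcongr
        rw [hsplit, abs_le]
        constructor <;> linarith
      have h2 : Ψ₂ x = 0 := by simp [Ψ₂, hxσ.not_gt]
      rw [h2, add_zero, hΨ₁, Set.indicator_of_mem (by simpa using hxσ)]
      calc (|∫ ξ in Metric.ball 0 ‖x‖, f ξ| / (2 * Real.pi * ‖x‖)) ^ 2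
          ≤ (Λ / σ₁ ^ 2 * (Real.pi * ‖x‖ ^ 2) / (2 * Real.pi * ‖x‖)) ^ 2 := by gcongr
        _ = Λ ^ 2 / (4 * σ₁ ^ 4) * ‖x‖ ^ 2 := by field_simp; ring
        _ ≤ Λ ^ 2 / (4 * σ₁ ^ 4) * σ₁ ^ 2 := by gcongr
        _ = Λ ^ 2 / (4 * σ₁ ^ 2) := by field_simp
    · have h1 : Ψ₁ x = 0 := by simp [Ψ₁, hxσ]
      rw [h1, zero_add]
      by_cases hx1 : ‖x‖ ≤ 1
      · have hm : |∫ ξ in Metric.ball 0 ‖x‖, f ξ| ≤ Λ := by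
          have hb₁ := h₁.setIntegral_le (Metric.ball 0 ‖x‖)
          have hb₂ := h₂.setIntegral_le (Metric.ball 0 ‖x‖)
          rw [hsplit, abs_le]
          constructor <;> linarith
        simp only [hΨ₂]
        rw [Set.indicator_of_mem (Set.mem_Ioc.2 ⟨not_le.1 hxσ, hx1⟩)]
        calc (|∫ ξ in Metric.ball 0 ‖x‖, f ξ| / (2 * Real.pi * ‖x‖)) ^ 2
            ≤ (Λ / (2 * Real.pi * ‖x‖)) ^ 2 := by gcongr
          _ = _ := by field_simp; ring
      · have hm : ∫ ξ in Metric.ball 0 ‖x‖, f ξ = 0 := by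
          rw [setIntegral_eq_integral_of_forall_compl_eq_zero,
            integral_sub h₁.integrable h₂.integrable, hmass, sub_self]
          intro ξ hξ
          by_contra h
          exact hξ (mem_ball_zero_iff.2 ((hR ξ h).trans_lt (not_le.1 hx1)))
        simp [hm, Ψ₂, hx1]
  have hΨ₁int : Integrable Ψ₁ :=
    (integrable_indicator_iff measurableSet_closedBall).2
      (integrableOn_const measure_closedBall_lt_top.ne)
  have hΨ₁val : ∫ x, Ψ₁ x = Real.pi * Λ ^ 2 / 4 := by
    rw [hΨ₁, integral_indicator measurableSet_closedBall, setIntegral_const, measureReal_def,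
      Measure.addHaar_closedBall_eq_addHaar_ball, ← measureReal_def,
      volume_real_ball_fin_two hσ₁.le, smul_eq_mul]
    field_simp
  have henergy : ∫ x, ‖gradient (logPotential ω₁ ω₂) x‖ ^ 2
      ≤ Λ ^ 2 * (1 + Real.log (1 / σ₁)) :=
    calc ∫ x, ‖gradient (logPotential ω₁ ω₂) x‖ ^ 2
        ≤ ∫ x, (Ψ₁ x + Ψ₂ x) := integral_mono_of_nonneg (.of_forall fun x ↦ by positivity)
          (hΨ₁int.add (hΨint.const_mul _)) (.of_forall hle)
      _ = Λ ^ 2 * (Real.pi / 4 + (1 / (2 * Real.pi)) * Real.log (1 / σ₁)) := by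
        rw [integral_add hΨ₁int (hΨint.const_mul _), hΨ₁val, integral_const_mul, hΨ]
        field_simp
        ring
      _ ≤ Λ ^ 2 * (1 + 1 * Real.log (1 / σ₁)) := by
        gcongr
        · linarith [Real.pi_le_four]
        · rw [div_le_one (by positivity)]
          linarith [Real.pi_gt_three]
      _ = Λ ^ 2 * (1 + Real.log (1 / σ₁)) := by rw [one_mul]
  calc Real.sqrt (∫ x, ‖gradient (logPotential ω₁ ω₂) x‖ ^ 2)
      ≤ Real.sqrt (Λ ^ 2 * (1 + Real.log (1 / σ₁))) := Real.sqrt_le_sqrt henergy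
    _ = 1 * Λ * Real.sqrt (1 + Real.log (1 / σ₁)) := by
      rw [Real.sqrt_mul (by positivity), Real.sqrt_sq hΛ.le, one_mul]
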